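/- Let Π ⊊ Σ_k be a proper subshift and T : Π → Σ_k the map constructed from Π. Then for every y ∈ Π, ω_{d̄}(T(y)) = ω_{d̄}(y) and ω_{d̲}(T(y)) = ω_{d̲}(y). -/

import Mathlib

open Filter Topology MeasureTheory

/-- Upper density of a set of naturals. -/
noncomputable def upperDensity (S : Set ℕ) : ℝ :=
  Filter.limsup (fun n => ((S ∩ Set.Iio n).ncard : ℝ) / n) Filter.atTop

/-- Lower density of a set of naturals. -/
noncomputable def lowerDensity (S : Set ℕ) : ℝ :=
  Filter.liminf (fun n => ((S ∩ Set.Iio n).ncard : ℝ) / n) Filter.atTop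

/-- Banach upper density: limsup over the interval length of the maximal
proportion of `S` in an interval of that length. -/
noncomputable def banachUpperDensity (S : Set ℕ) : ℝ :=
  Filter.limsup (fun N => ⨆ a : ℕ, ((S ∩ Set.Ico a (a + N)).ncard : ℝ) / N) Filter.atTop

/-- Banach lower density. -/
noncomputable def banachLowerDensity (S : Set ℕ) : ℝ :=
  Filter.liminf (fun N => ⨅ a : ℕ, ((S ∩ Set.Ico a (a + N)).ncard : ℝ) / N) Filter.atTop

/-- The shift map on the full shift `Σ_k = {0, …, k-1}^ℕ`. -/
def shift {k : ℕ} (x : ℕ → Fin k) : ℕ → Fin k := fun n => x (n + 1)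

/-- The metric `d(x,y) = Σ_{n ≥ 1} δ(x_n, y_n)/2^n` on `Σ_k` (sequences indexed from `0`). -/
noncomputable def shiftDist {k : ℕ} (x y : ℕ → Fin k) : ℝ :=
  ∑' n : ℕ, if x n = y n then 0 else (1 / 2) ^ (n + 1)

/-- The open ball `B_ε(x)` for the metric `shiftDist`. -/
def sball {k : ℕ} (x : ℕ → Fin k) (ε : ℝ) : Set (ℕ → Fin k) := {y | shiftDist x y < ε}

/-- `N(x, U) = {n ≥ 1 : σ^n(x) ∈ U}`. -/
def visits {k : ℕ} (x : ℕ → Fin k) (U : Set (ℕ → Fin k)) : Set ℕ :=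
  {n | 1 ≤ n ∧ shift^[n] x ∈ U}

/-- A point is recurrent if `N(x, B_ε(x)) ≠ ∅` for every `ε > 0`. -/
def Recurrent {k : ℕ} (x : ℕ → Fin k) : Prop := ∀ ε > (0 : ℝ), (visits x (sball x ε)).Nonempty

/-- A point is Banach recurrent if `N(x, B_ε(x))` has positive Banach upper density
for every `ε > 0`. -/
def BanachRecurrent {k : ℕ} (x : ℕ → Fin k) : Prop :=
  ∀ ε > (0 : ℝ), 0 < banachUpperDensity (visits x (sball x ε))

/-- Statistical ω-limit set w.r.t. a density notion `ξ`:
`ω_ξ(x) = {y : ξ(N(x, B_ε(y))) > 0 for all ε > 0}`. -/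
def statOmega {k : ℕ} (ξ : Set ℕ → ℝ) (x : ℕ → Fin k) : Set (ℕ → Fin k) :=
  {y | ∀ ε > (0 : ℝ), 0 < ξ (visits x (sball y ε))}

/-- The usual ω-limit set of `x` under the shift. -/
def omegaLim {k : ℕ} (x : ℕ → Fin k) : Set (ℕ → Fin k) :=
  {y | ∀ ε > (0 : ℝ), ∀ N : ℕ, ∃ n ≥ N, shift^[n] x ∈ sball y ε}

/-- Density of a subset of `Σ_k` w.r.t. the metric `shiftDist`. -/
def ShiftDense {k : ℕ} (A : Set (ℕ → Fin k)) : Prop :=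
  ∀ x : ℕ → Fin k, ∀ ε > (0 : ℝ), ∃ y ∈ A, shiftDist x y < ε

/-- Closure of a subset of `Σ_k` w.r.t. the metric `shiftDist`. -/
def shiftClosure {k : ℕ} (A : Set (ℕ → Fin k)) : Set (ℕ → Fin k) :=
  {z | ∀ ε > (0 : ℝ), ∃ y ∈ A, shiftDist z y < ε}

/-- `Φ^{(n)}_{xy}(t)`: the proportion of times `0 ≤ i < n` with `d(σ^i x, σ^i y) < t`. -/
noncomputable def PhiN {k : ℕ} (x y : ℕ → Fin k) (n : ℕ) (t : ℝ) : ℝ :=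
  (({i | i < n ∧ shiftDist (shift^[i] x) (shift^[i] y) < t}).ncard : ℝ) / n

/-- A pair is DC1 (distributionally chaotic of type 1) if `Φ_{xy}(s) = 0` for some `s > 0`
and `Φ*_{xy}(t) = 1` for all `t > 0`. -/
def DC1Pair {k : ℕ} (x y : ℕ → Fin k) : Prop :=
  (∃ s > (0 : ℝ), Filter.liminf (fun n => PhiN x y n s) Filter.atTop = 0) ∧
  (∀ t > (0 : ℝ), Filter.limsup (fun n => PhiN x y n t) Filter.atTop = 1)

/-- A set with at least two points is DC1-scrambled if every pair of distinct points is DC1. -/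
def DC1Scrambled {k : ℕ} (S : Set (ℕ → Fin k)) : Prop :=
  S.Nontrivial ∧ ∀ x ∈ S, ∀ y ∈ S, x ≠ y → DC1Pair x y

/-- `strictOrEq true A B` means `A ⊊ B`; `strictOrEq false A B` means `A = B`. -/
def strictOrEq {α : Type*} (b : Bool) (A B : Set α) : Prop := if b then A ⊂ B else A = B

/-- The patterns of (strict ⊊ = `true` / equality = `false`) for the three inclusions
`ω_{B_*} ⊆ ω_{d̲} ⊆ ω_{d̄} ⊆ ω_{B*}` in Cases (1)–(6). -/
def caseFlags : Fin 6 → Bool × Bool × Bool :=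
  ![(true, false, false), (true, false, true), (false, true, false),
    (true, true, false), (false, true, true), (true, true, true)]

/-- `x` satisfies Case (i), i = 1,…,6: the chain
`ω_{B_*}(x) ⊆ ω_{d̲}(x) ⊆ ω_{d̄}(x) ⊆ ω_{B*}(x) = ω_σ(x)` with strictness pattern given by
`caseFlags i`, and the last inclusion an equality. -/
def SatCase {k : ℕ} (i : Fin 6) (x : ℕ → Fin k) : Prop :=
  strictOrEq (caseFlags i).1 (statOmega banachLowerDensity x) (statOmega lowerDensity x) ∧
  strictOrEq (caseFlags i).2.1 (statOmega lowerDensity x) (statOmega upperDensity x) ∧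
  strictOrEq (caseFlags i).2.2 (statOmega upperDensity x) (statOmega banachUpperDensity x) ∧
  statOmega banachUpperDensity x = omegaLim x

/-- `x` satisfies Case (i'), i = 1,…,6: as in Case (i) but the last inclusion
`ω_{B*}(x) ⊆ ω_σ(x)` is strict. -/
def SatCase' {k : ℕ} (i : Fin 6) (x : ℕ → Fin k) : Prop :=
  strictOrEq (caseFlags i).1 (statOmega banachLowerDensity x) (statOmega lowerDensity x) ∧
  strictOrEq (caseFlags i).2.1 (statOmega lowerDensity x) (statOmega upperDensity x) ∧
  strictOrEq (caseFlags i).2.2 (statOmega upperDensity x) (statOmega banachUpperDensity x) ∧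
  statOmega banachUpperDensity x ⊂ omegaLim x
/-- A subshift: a nonempty, closed (w.r.t. the metric `shiftDist`), shift-invariant subset. -/
def IsSubshift {k : ℕ} (P : Set (ℕ → Fin k)) : Prop :=
  P.Nonempty ∧ shiftClosure P ⊆ P ∧ ∀ x ∈ P, shift x ∈ P

/-- The first `n` symbols of `y` as a finite word. -/
def prefixWord {k : ℕ} (y : ℕ → Fin k) (n : ℕ) : List (Fin k) :=
  List.ofFn (fun i : Fin n => y i)

/-- A finite word occurs in (the language of) `P` if it is the initial word of
some point of `P`. -/
def IsWordIn {k : ℕ} (w : List (Fin k)) (P : Set (ℕ → Fin k)) : Prop :=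
  ∃ x ∈ P, ∀ i : Fin w.length, x i = w.get i

/-- Data for the construction of the map `T`: an enumeration `C` of all (nonempty) finite
words of the subshift `P`, and a nonempty finite word `A1` not occurring in `P`. -/
structure TData (k : ℕ) (P : Set (ℕ → Fin k)) where
  C : ℕ → List (Fin k)
  A1 : List (Fin k)
  A1_ne : A1 ≠ []
  A1_not : ¬ IsWordIn A1 P
  C_in : ∀ n, IsWordIn (C n) P
  C_surj : ∀ w : List (Fin k), w ≠ [] → IsWordIn w P → ∃ n, C n = w

/-- The words `A_n` of the construction (indexed from `0`, so `TData.A y 0` is the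
paper's `A_1`): `A_{n+1} = A_n B_n A_n`, where `B_n = C_n Y_n ⋯ Y_n` consists of the
word `C_n` followed by `|A_n|²` copies of the initial word `Y_n` of `y` (paper's `Y_n`,
of length `n`, is `prefixWord y (n+1)` in our `0`-based indexing). -/
def TData.A {k : ℕ} {P : Set (ℕ → Fin k)} (D : TData k P) (y : ℕ → Fin k) :
    ℕ → List (Fin k)
  | 0 => D.A1
  | n + 1 =>
      D.A y n ++
        (D.C n ++ (List.replicate ((D.A y n).length ^ 2) (prefixWord y (n + 1))).flatten) ++
        D.A y n

/-- The requirement `|C_n| = o(|A_n|)` as `n → ∞`. -/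
def TData.Small {k : ℕ} {P : Set (ℕ → Fin k)} (D : TData k P) : Prop :=
  ∀ y : ℕ → Fin k,
    Filter.Tendsto (fun n => ((D.C n).length : ℝ) / ((D.A y n).length))
      Filter.atTop (nhds 0)

/-- The map `T`: `T(y) = lim_n A_n` is the sequence whose `i`-th symbol is the `i`-th
symbol of `A_n` for every large `n` (the words `A_n` are nested prefixes of each other,
and `|A_{i+1}| > i`, so the `i`-th symbol of `A_{i+1}` is well defined). -/
def TData.T {k : ℕ} {P : Set (ℕ → Fin k)} (D : TData k P) (y : ℕ → Fin k) : ℕ → Fin k :=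
  fun i => if h : i < (D.A y (i + 1)).length then (D.A y (i + 1)).get ⟨i, h⟩ else y i


section Helpers
open Classical

def cyl {k : ℕ} (z : ℕ → Fin k) (L : ℕ) : Set (ℕ → Fin k) := {x | ∀ i < L, x i = z i}

noncomputable def cnt (S : Set ℕ) (n : ℕ) : ℕ := Nat.count (fun i => i ∈ S) n

lemma ncard_eq_cnt (S : Set ℕ) (n : ℕ) : (S ∩ Set.Iio n).ncard = cnt S n := by
  unfold cnt
  rw [Nat.count_eq_card_filter_range, ← Set.ncard_coe_finset]
  congr 1
  ext i
  simp [and_comm]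

lemma cnt_mono_set {S S' : Set ℕ} (h : S ⊆ S') (n : ℕ) : cnt S n ≤ cnt S' n := by
  unfold cnt
  exact Nat.count_mono_left (fun i _ hi => h hi)

lemma cnt_le (S : Set ℕ) (n : ℕ) : cnt S n ≤ n := Nat.count_le _

lemma cnt_mono (S : Set ℕ) {m n : ℕ} (h : m ≤ n) : cnt S m ≤ cnt S n := Nat.count_monotone _ h

lemma cnt_add_le (S : Set ℕ) (m r : ℕ) : cnt S (m + r) ≤ cnt S m + r := by
  unfold cnt
  rw [Nat.count_add]
  have := @Nat.count_le (fun k => (m + k) ∈ S) _ r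
  omega

lemma ratio_nonneg (S : Set ℕ) (n : ℕ) : 0 ≤ (cnt S n : ℝ) / n := by positivity

lemma ratio_le (S : Set ℕ) (n : ℕ) : (cnt S n : ℝ) / n ≤ 1 := by
  apply div_le_one_of_le₀
  · exact_mod_cast cnt_le S n
  · positivity

lemma upper_pos_iff (S : Set ℕ) :
    0 < upperDensity S ↔ ∃ c > (0:ℝ), ∃ᶠ n in atTop, c < (cnt S n : ℝ) / n := by
  unfold upperDensity
  simp only [ncard_eq_cnt]
  have hb : IsBoundedUnder (· ≤ ·) atTop (fun n => (cnt S n : ℝ) / n) :=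
    isBoundedUnder_of ⟨1, ratio_le S⟩
  have hb' : IsBoundedUnder (· ≥ ·) atTop (fun n => (cnt S n : ℝ) / n) :=
    isBoundedUnder_of ⟨0, ratio_nonneg S⟩
  constructor
  · intro h
    obtain ⟨c, hc, hc'⟩ := exists_between h
    exact ⟨c, hc, frequently_lt_of_lt_limsup hb'.isCoboundedUnder_le hc'⟩
  · rintro ⟨c, hc, h⟩
    refine lt_of_lt_of_le hc ?_
    exact le_limsup_of_frequently_le (h.mono fun _ h => h.le) hb

lemma lower_pos_iff (S : Set ℕ) :
    0 < lowerDensity S ↔ ∃ c > (0:ℝ), ∀ᶠ n in atTop, c < (cnt S n : ℝ) / n := by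
  unfold lowerDensity
  simp only [ncard_eq_cnt]
  have hb : IsBoundedUnder (· ≤ ·) atTop (fun n => (cnt S n : ℝ) / n) :=
    isBoundedUnder_of ⟨1, ratio_le S⟩
  have hb' : IsBoundedUnder (· ≥ ·) atTop (fun n => (cnt S n : ℝ) / n) :=
    isBoundedUnder_of ⟨0, ratio_nonneg S⟩
  constructor
  · intro h
    obtain ⟨c, hc, hc'⟩ := exists_between h
    exact ⟨c, hc, eventually_lt_of_lt_liminf hc' hb'⟩
  · rintro ⟨c, hc, h⟩
    refine lt_of_lt_of_le hc ?_
    exact le_liminf_of_le hb.isCoboundedUnder_ge (h.mono fun _ h => h.le)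

lemma ratio_mono {S S' : Set ℕ} (h : S ⊆ S') (n : ℕ) :
    (cnt S n : ℝ) / n ≤ (cnt S' n : ℝ) / n := by
  have := cnt_mono_set h n
  gcongr

lemma upper_pos_mono {S S' : Set ℕ} (h : S ⊆ S') (hS : 0 < upperDensity S) :
    0 < upperDensity S' := by
  rw [upper_pos_iff] at *
  obtain ⟨c, hc, hf⟩ := hS
  exact ⟨c, hc, hf.mono fun n hn => hn.trans_le (ratio_mono h n)⟩

lemma lower_pos_mono {S S' : Set ℕ} (h : S ⊆ S') (hS : 0 < lowerDensity S) :
    0 < lowerDensity S' := by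
  rw [lower_pos_iff] at *
  obtain ⟨c, hc, hf⟩ := hS
  exact ⟨c, hc, hf.mono fun n hn => hn.trans_le (ratio_mono h n)⟩

lemma sd_summable {k : ℕ} (x y : ℕ → Fin k) :
    Summable (fun n : ℕ => if x n = y n then (0:ℝ) else (1 / 2) ^ (n + 1)) := by
  have h : Summable (fun n : ℕ => ((1:ℝ) / 2) ^ (n + 1)) :=
    (summable_nat_add_iff 1).2 summable_geometric_two
  refine Summable.of_nonneg_of_le (fun n => ?_) (fun n => ?_) h
  · split_ifs <;> positivity
  · split_ifs
    · positivity
    · exact le_rfl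

lemma cyl_sub_ball {k : ℕ} (z : ℕ → Fin k) (ε : ℝ) (hε : 0 < ε) :
    ∃ L, cyl z L ⊆ sball z ε := by
  obtain ⟨L, hL⟩ := exists_pow_lt_of_lt_one hε (by norm_num : (1/2:ℝ) < 1)
  refine ⟨L, fun x hx => ?_⟩
  change shiftDist z x < ε
  refine lt_of_le_of_lt ?_ hL
  unfold shiftDist
  have hs := sd_summable z x
  rw [← hs.sum_add_tsum_nat_add L]
  have h0 : ∑ i ∈ Finset.range L, (if z i = x i then (0:ℝ) else (1 / 2) ^ (i + 1)) = 0 := by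
    apply Finset.sum_eq_zero
    intro i hi
    rw [if_pos (hx i (Finset.mem_range.1 hi)).symm]
  rw [h0, zero_add]
  have hg : HasSum (fun n : ℕ => ((1:ℝ)/2)^L * (1/2/2^n)) ((1/2)^L * 1) :=
    (hasSum_geometric_two' 1).mul_left _
  rw [mul_one] at hg
  have hle : ∀ n : ℕ, (if z (n + L) = x (n + L) then (0:ℝ) else (1 / 2) ^ (n + L + 1)) ≤
      ((1:ℝ)/2)^L * (1/2/2^n) := by
    intro n
    have e : ((1:ℝ)/2)^L * (1/2/2^n) = (1/2)^(n+L+1) := by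
      rw [pow_succ, pow_add, one_div_pow (2:ℝ) n]; ring
    rw [e]
    split_ifs
    · positivity
    · exact le_rfl
  exact hasSum_le hle ((summable_nat_add_iff L).2 hs).hasSum hg

lemma ball_sub_cyl {k : ℕ} (z : ℕ → Fin k) (L : ℕ) :
    ∃ ε > (0:ℝ), sball z ε ⊆ cyl z L := by
  refine ⟨(1/2)^(L+1), by positivity, fun x hx i hi => ?_⟩
  by_contra hne
  have hx' : shiftDist z x < (1/2)^(L+1) := hx
  have h1 : (if z i = x i then (0:ℝ) else (1 / 2) ^ (i + 1)) ≤ shiftDist z x := by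
    unfold shiftDist
    refine (sd_summable z x).le_tsum i (fun j _ => ?_)
    split_ifs <;> positivity
  rw [if_neg (fun h => hne h.symm)] at h1
  have h2 : ((1:ℝ)/2)^(L+1) ≤ (1/2)^(i+1) :=
    pow_le_pow_of_le_one (by norm_num) (by norm_num) (by omega)
  linarith

lemma visits_mono {k : ℕ} (x : ℕ → Fin k) {U V : Set (ℕ → Fin k)} (h : U ⊆ V) :
    visits x U ⊆ visits x V := fun _ hn => ⟨hn.1, h hn.2⟩

lemma statOmega_cyl {k : ℕ} (ξ : Set ℕ → ℝ)
    (hξ : ∀ S S' : Set ℕ, S ⊆ S' → 0 < ξ S → 0 < ξ S') (x : ℕ → Fin k) :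
    statOmega ξ x = {z | ∀ L, 0 < ξ (visits x (cyl z L))} := by
  ext z
  constructor
  · intro h L
    obtain ⟨ε, hε, hs⟩ := ball_sub_cyl z L
    exact hξ _ _ (visits_mono x hs) (h ε hε)
  · intro h ε hε
    obtain ⟨L, hs⟩ := cyl_sub_ball z ε hε
    exact hξ _ _ (visits_mono x hs) (h L)

lemma shift_iter {k : ℕ} (x : ℕ → Fin k) (n i : ℕ) : shift^[n] x i = x (n + i) := by
  induction n generalizing x with
  | zero => simp
  | succ n ih => rw [Function.iterate_succ_apply, ih]; unfold shift; congr 1; omega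

lemma mem_visits_cyl {k : ℕ} (x z : ℕ → Fin k) (L n : ℕ) :
    n ∈ visits x (cyl z L) ↔ 1 ≤ n ∧ ∀ i < L, x (n + i) = z i := by
  simp [visits, cyl, shift_iter]

/-- structure of T -/
lemma A_len_succ {k : ℕ} {P : Set (ℕ → Fin k)} (D : TData k P) (y : ℕ → Fin k) (n : ℕ) :
    (D.A y (n+1)).length = (D.A y n).length + (D.C n).length
      + (D.A y n).length^2 * (n+1) + (D.A y n).length := by
  simp [TData.A, prefixWord]
  ring

lemma A_len_ge {k : ℕ} {P : Set (ℕ → Fin k)} (D : TData k P) (y : ℕ → Fin k) (n : ℕ) :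
    2^n ≤ (D.A y n).length := by
  induction n with
  | zero => simpa [TData.A, Nat.one_le_iff_ne_zero] using D.A1_ne
  | succ n ih => rw [A_len_succ, pow_succ]; nlinarith [Nat.zero_le ((D.A y n).length^2 * (n+1))]

lemma A_prefix {k : ℕ} {P : Set (ℕ → Fin k)} (D : TData k P) (y : ℕ → Fin k) {m n : ℕ}
    (h : m ≤ n) : D.A y m <+: D.A y n := by
  induction n, h using Nat.le_induction with
  | base => exact List.prefix_rfl
  | succ n _ ih =>
    refine ih.trans ?_
    simp only [TData.A, List.append_assoc]
    exact List.prefix_append _ _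

lemma T_get {k : ℕ} {P : Set (ℕ → Fin k)} (D : TData k P) (y : ℕ → Fin k) (n i : ℕ)
    (h : i < (D.A y n).length) : (D.A y n)[i]? = some (D.T y i) := by
  have hi : i < (D.A y (i+1)).length :=
    lt_of_lt_of_le (lt_trans (Nat.lt_succ_self i) (Nat.lt_two_pow_self)) (A_len_ge D y (i+1))
  have hT : D.T y i = (D.A y (i+1))[i] := by
    unfold TData.T
    rw [dif_pos hi]; rfl
  rw [hT, List.getElem?_eq_getElem h]
  congr 1
  rcases le_total n (i+1) with hle | hle
  · exact (A_prefix D y hle).getElem h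
  · exact ((A_prefix D y hle).getElem hi).symm

lemma flat_get {α : Type*} (w : List α) (M m r : ℕ) (hm : m < M) (hr : r < w.length) :
    ((List.replicate M w).flatten)[m * w.length + r]? = w[r]? := by
  induction M generalizing m with
  | zero => omega
  | succ M ih =>
    rw [List.replicate_succ, List.flatten_cons]
    cases m with
    | zero => rw [List.getElem?_append_left (by omega)]; congr 1; omega
    | succ m =>
      rw [List.getElem?_append_right (by rw [Nat.succ_mul]; omega), ← ih m (by omega)]
      congr 1
      rw [Nat.succ_mul]; omega

lemma T_block {k : ℕ} {P : Set (ℕ → Fin k)} (D : TData k P) (y : ℕ → Fin k) (n m r : ℕ)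
    (hm : m < (D.A y n).length^2) (hr : r < n+1) :
    D.T y ((D.A y n).length + (D.C n).length + m * (n+1) + r) = y r := by
  have hlen := A_len_succ D y n
  have hmul : m * (n+1) + (n+1) ≤ (D.A y n).length^2 * (n+1) := by
    rw [← Nat.succ_mul]; exact Nat.mul_le_mul_right _ hm
  have h := T_get D y (n+1) ((D.A y n).length + (D.C n).length + m * (n+1) + r) (by omega)
  have hw : (prefixWord y (n+1)).length = n+1 := by simp [prefixWord]
  have h2 := flat_get (prefixWord y (n+1)) ((D.A y n).length^2) m r hm (by omega)
  have hl : ((List.replicate ((D.A y n).length^2) (prefixWord y (n+1))).flatten).length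
      = (D.A y n).length^2 * (n+1) := by simp [hw]
  rw [hw] at h2
  simp only [TData.A, List.append_assoc] at h
  rw [List.getElem?_append_right (by omega), List.getElem?_append_right (by omega),
    List.getElem?_append_left (by omega)] at h
  have e : (D.A y n).length + (D.C n).length + m * (n+1) + r - (D.A y n).length - (D.C n).length
    = m * (n+1) + r := by omega
  rw [e, h2] at h
  have h3 : (prefixWord y (n+1))[r]? = some (y r) := by
    rw [List.getElem?_eq_getElem (by omega)]
    simp only [prefixWord, List.getElem_ofFn]
  rw [h3] at h
  exact (Option.some.inj h).symm

/-- counting -/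
lemma count_cmp (p q : ℕ → Prop) (m L : ℕ) (h : ∀ i, 1 ≤ i → i + L ≤ m → (p i → q i)) :
    Nat.count p m ≤ Nat.count q m + (L + 1) := by
  have h1 : ∀ s, s + L ≤ m + 1 → Nat.count p s ≤ Nat.count q s + 1 := by
    intro s
    induction s with
    | zero => simp
    | succ s ih =>
      intro hs
      rcases Nat.eq_zero_or_pos s with rfl | hpos
      · simp only [Nat.count_succ, Nat.count_zero]; split_ifs <;> omega
      · have := ih (by omega)
        have hh := h s hpos (by omega)
        simp only [Nat.count_succ]
        split_ifs <;> first | omega | (exfalso; tauto)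
  rcases le_total L m with hL | hL
  · have h2 := h1 (m - L) (by omega)
    obtain ⟨s, rfl⟩ := Nat.exists_eq_add_of_le hL
    rw [Nat.add_sub_cancel_left] at h2
    rw [Nat.add_comm L s, Nat.count_add, Nat.count_add]
    have := @Nat.count_le (fun k => p (s + k)) _ L
    omega
  · have := @Nat.count_le p _ m
    omega

lemma block_count {k : ℕ} (x y z : ℕ → Fin k) (L p m : ℕ) (h : ∀ i < m, x (p + i) = y i) :
    cnt (visits x (cyl z L)) (p + m) ≤
      cnt (visits x (cyl z L)) p + cnt (visits y (cyl z L)) m + (L + 1) ∧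
    cnt (visits x (cyl z L)) p + cnt (visits y (cyl z L)) m ≤
      cnt (visits x (cyl z L)) (p + m) + (L + 1) := by
  have key : ∀ i, 1 ≤ i → i + L ≤ m →
      (p + i ∈ visits x (cyl z L) ↔ i ∈ visits y (cyl z L)) := by
    intro i hi hiL
    rw [mem_visits_cyl, mem_visits_cyl]
    constructor
    · rintro ⟨_, h2⟩
      refine ⟨hi, fun j hj => ?_⟩
      rw [← h2 j hj, ← h (i + j) (by omega), add_assoc]
    · rintro ⟨_, h2⟩
      refine ⟨by omega, fun j hj => ?_⟩
      rw [← h2 j hj, ← h (i + j) (by omega), add_assoc]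
  unfold cnt
  rw [Nat.count_add]
  have h1 := count_cmp (fun i => p + i ∈ visits x (cyl z L)) (fun i => i ∈ visits y (cyl z L)) m L
    (fun i h1 h2 => (key i h1 h2).1)
  have h2 := count_cmp (fun i => i ∈ visits y (cyl z L)) (fun i => p + i ∈ visits x (cyl z L)) m L
    (fun i h1 h2 => (key i h1 h2).2)
  omega

end Helpers

section Abstract

lemma dev_step (G : ℕ → ℕ) (h1 : ∀ m r, G m ≤ G (m + r)) (h2 : ∀ m r, G (m + r) ≤ G m + r)
    (f : ℝ) (hf0 : 0 ≤ f) (hf1 : f ≤ 1) (N r : ℕ) :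
    |((G (N + r) : ℝ) - f * ((N + r : ℕ) : ℝ)) - ((G N : ℝ) - f * N)| ≤ r := by
  have a1 : (G N : ℝ) ≤ G (N + r) := by exact_mod_cast h1 N r
  have a2 : (G (N + r) : ℝ) ≤ G N + r := by exact_mod_cast h2 N r
  have hr : (0:ℝ) ≤ r := by positivity
  push_cast
  rw [abs_le]
  constructor <;> nlinarith

lemma dev_blocks (G : ℕ → ℕ) (gn n K Q M : ℕ)
    (hb : ∀ m < M, G (Q + m * (n+1) + (n+1)) ≤ G (Q + m * (n+1)) + gn + K ∧
      G (Q + m * (n+1)) + gn ≤ G (Q + m * (n+1) + (n+1)) + K) (m : ℕ) (hm : m ≤ M) :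
    |((G (Q + m * (n+1)) : ℝ) - ((gn : ℝ) / (n+1)) * ((Q + m * (n+1) : ℕ) : ℝ))
      - ((G Q : ℝ) - ((gn : ℝ) / (n+1)) * Q)| ≤ m * K := by
  induction m with
  | zero => simp
  | succ m ih =>
    have ih := ih (by omega)
    obtain ⟨b1, b2⟩ := hb m (by omega)
    have e : Q + (m+1) * (n+1) = Q + m * (n+1) + (n+1) := by ring
    rw [e]
    have c1 : (G (Q + m * (n+1) + (n+1)) : ℝ) ≤ G (Q + m * (n+1)) + gn + K := by exact_mod_cast b1
    have c2 : (G (Q + m * (n+1)) : ℝ) + gn ≤ G (Q + m * (n+1) + (n+1)) + K := by exact_mod_cast b2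
    have hgn : (gn : ℝ) / (n+1) * (n+1) = gn := by field_simp
    have e2 : (gn : ℝ) / (n+1) * ((Q + m * (n+1) + (n+1) : ℕ) : ℝ)
        = (gn : ℝ) / (n+1) * ((Q + m * (n+1) : ℕ) : ℝ) + gn := by
      rw [Nat.cast_add _ (n+1), mul_add]
      congr 1
      push_cast
      exact hgn
    rw [e2]
    rw [abs_le] at ih ⊢
    obtain ⟨i1, i2⟩ := ih
    push_cast at *
    constructor <;> linarith

/-- error term -/
noncomputable def verr (a c : ℕ → ℕ) (K n : ℕ) : ℝ :=
  (c n : ℝ) / a n + (K : ℝ) / (n+1) + ((n:ℝ)+1) / a n + 1 / ((n:ℝ)+1)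

lemma main1 (G a c : ℕ → ℕ) (gn n K : ℕ) (hgn : gn ≤ n + 1)
    (h1 : ∀ m r, G m ≤ G (m + r)) (h2 : ∀ m r, G (m + r) ≤ G m + r)
    (hb : ∀ m < a n ^ 2, G (a n + c n + m * (n+1) + (n+1)) ≤ G (a n + c n + m * (n+1)) + gn + K ∧
      G (a n + c n + m * (n+1)) + gn ≤ G (a n + c n + m * (n+1) + (n+1)) + K)
    (ha : a (n+1) = a n + c n + a n ^ 2 * (n+1) + a n) (ha1 : 1 ≤ a n)
    (N : ℕ) (hN : a n ≤ N) (hN' : N ≤ a (n+1)) :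
    |(G N : ℝ) - ((gn : ℝ) / (n+1)) * N| ≤
      |(G (a n) : ℝ) - ((gn : ℝ) / (n+1)) * (a n)| + verr a c K n * N := by
  set f : ℝ := (gn : ℝ) / (n+1) with hf
  have hf0 : 0 ≤ f := by positivity
  have hf1 : f ≤ 1 := by
    rw [hf, div_le_one (by positivity)]; exact_mod_cast hgn
  have step := dev_step G h1 h2 f hf0 hf1
  have hap : (0:ℝ) < a n := by exact_mod_cast ha1
  have hNa : (a n : ℝ) ≤ N := by exact_mod_cast hN
  have hn1 : (0:ℝ) < (n:ℝ) + 1 := by positivity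
  have t1 : (c n : ℝ) ≤ (c n : ℝ) / a n * N := by
    rw [div_mul_eq_mul_div, le_div_iff₀ hap]; gcongr
  have t3 : ((n:ℝ)+1) ≤ ((n:ℝ)+1) / a n * N := by
    rw [div_mul_eq_mul_div, le_div_iff₀ hap]; gcongr
  have p2 : 0 ≤ (K : ℝ) / (n+1) * N := by positivity
  have p3 : 0 ≤ ((n:ℝ)+1) / a n * N := by positivity
  have p4 : 0 ≤ 1 / ((n:ℝ)+1) * N := by positivity
  have hv : verr a c K n * N = (c n : ℝ) / a n * N + (K : ℝ) / (n+1) * N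
      + ((n:ℝ)+1) / a n * N + 1 / ((n:ℝ)+1) * N := by unfold verr; ring
  rw [hv]
  have tri : ∀ u v w : ℝ, |u - v| ≤ w → |u| ≤ |v| + w := by
    intro u v w h
    have := abs_sub_abs_le_abs_sub u v
    linarith
  rcases le_total N (a n + c n) with hc | hc
  · obtain ⟨r, rfl⟩ := Nat.exists_eq_add_of_le hN
    have s := tri _ _ _ (step (a n) r)
    have hr : (r : ℝ) ≤ c n := by exact_mod_cast (by omega : r ≤ c n)
    linarith
  · have s1 := tri _ _ _ (step (a n) (c n))
    have blk := dev_blocks G gn n K (a n + c n) (a n ^ 2) hb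
    have mK : ∀ m : ℕ, a n + c n + m * (n+1) ≤ N → (m : ℝ) * K ≤ (K : ℝ) / (n+1) * N := by
      intro m hm
      rw [div_mul_eq_mul_div, le_div_iff₀ hn1]
      have : (m : ℝ) * (n+1) ≤ N := by exact_mod_cast (by omega : m * (n+1) ≤ N)
      nlinarith [(Nat.cast_nonneg K : (0:ℝ) ≤ K)]
    obtain ⟨t, rfl⟩ := Nat.exists_eq_add_of_le hc
    rcases lt_or_ge t (a n ^ 2 * (n+1)) with ht | ht
    · have hmod := Nat.div_add_mod' t (n+1)
      have hlt := Nat.mod_lt t (Nat.succ_pos n)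
      set m := t / (n+1) with hm
      set r := t % (n+1) with hr
      have hmM : m < a n ^ 2 := by rw [hm]; exact Nat.div_lt_of_lt_mul (by rwa [mul_comm])
      have s2 := tri _ _ _ (blk m hmM.le)
      have s3 := tri _ _ _ (step (a n + c n + m * (n+1)) r)
      have e : a n + c n + m * (n+1) + r = a n + c n + t := by omega
      rw [e] at s3
      have hr' : (r : ℝ) ≤ n + 1 := by exact_mod_cast hlt.le
      have := mK m (by omega)
      linarith
    · obtain ⟨r, rfl⟩ := Nat.exists_eq_add_of_le ht
      have s2 := tri _ _ _ (blk (a n ^ 2) le_rfl)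
      have s3 := tri _ _ _ (step (a n + c n + a n ^ 2 * (n+1)) r)
      rw [add_assoc (a n + c n)] at s3
      have hr' : (r : ℝ) ≤ a n := by exact_mod_cast (by omega : r ≤ a n)
      have hq := mK (a n ^ 2) (by omega)
      have t4 : (a n : ℝ) ≤ 1 / ((n:ℝ)+1) * ((a n + c n + (a n ^ 2 * (n+1) + r) : ℕ) : ℝ) := by
        rw [div_mul_eq_mul_div, le_div_iff₀ hn1, one_mul]
        have h3 : a n * (n+1) ≤ a n + c n + (a n ^ 2 * (n+1) + r) := by
          have : a n * (n+1) ≤ a n ^ 2 * (n+1) :=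
            Nat.mul_le_mul_right _ (Nat.le_self_pow (by norm_num) _)
          omega
        exact_mod_cast h3
      linarith

lemma main2 (G g a c : ℕ → ℕ) (K : ℕ) (hG : ∀ n, G n ≤ n) (hg : ∀ n, g n ≤ n)
    (h1 : ∀ m r, G m ≤ G (m + r)) (h2 : ∀ m r, G (m + r) ≤ G m + r)
    (g1 : ∀ m r, g m ≤ g (m + r)) (g2 : ∀ m r, g (m + r) ≤ g m + r)
    (hb : ∀ n, ∀ m < a n ^ 2,
      G (a n + c n + m * (n+1) + (n+1)) ≤ G (a n + c n + m * (n+1)) + g (n+1) + K ∧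
      G (a n + c n + m * (n+1)) + g (n+1) ≤ G (a n + c n + m * (n+1) + (n+1)) + K)
    (ha : ∀ n, a (n+1) = a n + c n + a n ^ 2 * (n+1) + a n) (ha1 : ∀ n, 1 ≤ a n)
    (n N : ℕ) (hN : a (n+1) ≤ N) (hN' : N ≤ a (n+2)) :
    |(G N : ℝ) / N - (g (n+2) : ℝ) / ((n+2 : ℕ) : ℝ)| ≤
      verr a c K n + 2 / ((n:ℝ)+1) + verr a c K (n+1) := by
  have m1 := main1 G a c (g (n+1)) n K (hg _) h1 h2 (hb n) (ha n) (ha1 n) (a (n+1))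
    (by rw [ha n]; omega) le_rfl
  have m2 := main1 G a c (g (n+2)) (n+1) K (hg _) h1 h2 (hb (n+1)) (ha (n+1)) (ha1 (n+1)) N hN hN'
  have hn1 : (0:ℝ) < (n:ℝ) + 1 := by positivity
  have hap : (0:ℝ) < a (n+1) := by exact_mod_cast ha1 (n+1)
  have hNa : (a (n+1) : ℝ) ≤ N := by exact_mod_cast hN
  have hNp : (0:ℝ) < N := hap.trans_le hNa
  have f1 : (g (n+1) : ℝ) / (n+1) ≤ 1 := by
    rw [div_le_one hn1]; exact_mod_cast hg (n+1)
  have f0 : 0 ≤ (g (n+1) : ℝ) / (n+1) := by positivity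
  have b0 : |(G (a n) : ℝ) - ((g (n+1) : ℝ) / (n+1)) * (a n)| ≤ 1 / ((n:ℝ)+1) * a (n+1) := by
    have q1 : (G (a n) : ℝ) ≤ a n := by exact_mod_cast hG _
    have q2 : (a n : ℝ) ≤ 1 / ((n:ℝ)+1) * a (n+1) := by
      rw [div_mul_eq_mul_div, le_div_iff₀ hn1, one_mul]
      have h3 : a n * (n+1) ≤ a (n+1) := by
        have : a n * (n+1) ≤ a n ^ 2 * (n+1) :=
          Nat.mul_le_mul_right _ (Nat.le_self_pow (by norm_num) _)
        rw [ha n]; omega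
      exact_mod_cast h3
    have q3 : (0:ℝ) ≤ a n := by positivity
    have q4 : (0:ℝ) ≤ G (a n) := by positivity
    rw [abs_le]
    constructor <;> nlinarith
  have fd : |(g (n+1) : ℝ) / (n+1) - (g (n+2) : ℝ) / (((n+1 : ℕ) : ℝ)+1)| ≤ 1 / ((n:ℝ)+1) := by
    have r1 : (g (n+1) : ℝ) ≤ g (n+2) := by exact_mod_cast g1 (n+1) 1
    have r2 : (g (n+2) : ℝ) ≤ g (n+1) + 1 := by exact_mod_cast g2 (n+1) 1
    have r3 : (g (n+1) : ℝ) ≤ n + 1 := by exact_mod_cast hg (n+1)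
    have r4 : (0:ℝ) ≤ g (n+1) := by positivity
    push_cast
    rw [div_sub_div _ _ (by positivity) (by positivity), abs_le, ← neg_div]
    have w1 : -((n:ℝ)+1) ≤ (g (n+1) : ℝ) * ((n:ℝ)+1+1) - ((n:ℝ)+1) * g (n+2) := by nlinarith
    have w2 : (g (n+1) : ℝ) * ((n:ℝ)+1+1) - ((n:ℝ)+1) * g (n+2) ≤ (n:ℝ)+1 := by nlinarith
    have w3 := mul_le_mul_of_nonneg_right w1 hn1.le
    have w4 := mul_le_mul_of_nonneg_right w2 hn1.le
    constructor
    · rw [div_le_div_iff₀ (by positivity) (by positivity)]; nlinarith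
    · rw [div_le_div_iff₀ (by positivity) (by positivity)]; nlinarith
  have b1 : |(G (a (n+1)) : ℝ) - (g (n+2) : ℝ) / (((n+1 : ℕ) : ℝ)+1) * (a (n+1))| ≤
      (verr a c K n + 2 / ((n:ℝ)+1)) * a (n+1) := by
    have e : (G (a (n+1)) : ℝ) - (g (n+2) : ℝ) / (((n+1 : ℕ) : ℝ)+1) * (a (n+1))
      = ((G (a (n+1)) : ℝ) - (g (n+1) : ℝ) / (n+1) * (a (n+1))) +
        ((g (n+1) : ℝ) / (n+1) - (g (n+2) : ℝ) / (((n+1 : ℕ) : ℝ)+1)) * (a (n+1)) := by ring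
    rw [e]
    refine (abs_add_le _ _).trans ?_
    rw [abs_mul, abs_of_pos hap]
    have := mul_le_mul_of_nonneg_right fd hap.le
    have e2 : (2:ℝ) / ((n:ℝ)+1) = 1 / ((n:ℝ)+1) + 1 / ((n:ℝ)+1) := by ring
    rw [e2]
    linarith
  have hv0 : 0 ≤ verr a c K n + 2 / ((n:ℝ)+1) := by unfold verr; positivity
  have b2 := mul_le_mul_of_nonneg_left hNa hv0
  have e3 : (G N : ℝ) / N - (g (n+2) : ℝ) / ((n+2 : ℕ) : ℝ)
      = ((G N : ℝ) - (g (n+2) : ℝ) / (((n+1 : ℕ) : ℝ)+1) * N) / N := by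
    rw [sub_div, mul_div_cancel_right₀ _ hNp.ne']
    push_cast
    ring
  rw [e3, abs_div, abs_of_pos hNp, div_le_iff₀ hNp]
  linarith

lemma verr_tendsto (a c : ℕ → ℕ) (K : ℕ) (ha2 : ∀ n, 2 ^ n ≤ a n)
    (hc : Tendsto (fun n => (c n : ℝ) / a n) atTop (nhds 0)) :
    Tendsto (fun n => verr a c K n) atTop (nhds 0) := by
  have i1 : Tendsto (fun n : ℕ => (1:ℝ) / ((n:ℝ)+1)) atTop (nhds 0) :=
    tendsto_one_div_add_atTop_nhds_zero_nat
  have i2 : Tendsto (fun n : ℕ => (K:ℝ) / ((n:ℝ)+1)) atTop (nhds 0) := by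
    have := i1.const_mul (K:ℝ)
    simpa [div_eq_mul_inv] using this
  have i3 : Tendsto (fun n : ℕ => ((n:ℝ)+1) / a n) atTop (nhds 0) := by
    have j1 : Tendsto (fun n : ℕ => (n:ℝ) * (1/2)^n) atTop (nhds 0) :=
      tendsto_self_mul_const_pow_of_lt_one (by norm_num) (by norm_num)
    have j2 : Tendsto (fun n : ℕ => ((1:ℝ)/2)^n) atTop (nhds 0) :=
      tendsto_pow_atTop_nhds_zero_of_lt_one (by norm_num) (by norm_num)
    have j3 := j1.add j2
    rw [add_zero] at j3
    refine squeeze_zero (fun n => by positivity) (fun n => ?_) j3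
    have h : (2:ℝ)^n ≤ a n := by exact_mod_cast ha2 n
    calc ((n:ℝ)+1) / a n ≤ ((n:ℝ)+1) / 2^n := by gcongr
      _ = _ := by rw [one_div, inv_pow]; ring
  have := ((hc.add i2).add i3).add i1
  simpa [verr] using this

lemma level (a : ℕ → ℕ) (ha2 : ∀ n, 2 ^ n ≤ a n) (n0 N : ℕ) (h : a (n0+1) ≤ N) :
    ∃ n ≥ n0, a (n+1) ≤ N ∧ N ≤ a (n+2) := by
  by_contra hcon
  push Not at hcon
  have : ∀ j, a (n0 + j + 1) ≤ N := by
    intro j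
    induction j with
    | zero => exact h
    | succ j ih => exact (hcon (n0 + j) (by omega) ih).le
  have h1 := this N
  have h2 := ha2 (n0 + N + 1)
  have h3 : n0 + N + 1 < 2 ^ (n0 + N + 1) := Nat.lt_two_pow_self
  omega

lemma transfer (X F : ℕ → ℝ) (a : ℕ → ℕ) (u : ℕ → ℝ) (ha2 : ∀ n, 2 ^ n ≤ a n)
    (hmono : ∀ n, a n ≤ a (n+1))
    (hu : Tendsto u atTop (nhds 0))
    (h : ∀ n N, a (n+1) ≤ N → N ≤ a (n+2) → |X N - F (n+2)| ≤ u n) :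
    ((∃ c > (0:ℝ), ∃ᶠ n in atTop, c < X n) ↔ (∃ c > (0:ℝ), ∃ᶠ n in atTop, c < F n)) ∧
    ((∃ c > (0:ℝ), ∀ᶠ n in atTop, c < X n) ↔ (∃ c > (0:ℝ), ∀ᶠ n in atTop, c < F n)) := by
  have hu' : ∀ c > (0:ℝ), ∃ n0, ∀ n ≥ n0, u n < c := by
    intro c hc
    exact eventually_atTop.1 (hu.eventually_lt_const hc)
  have hge : ∀ n, n ≤ a n := fun n => (Nat.lt_two_pow_self).le.trans (ha2 n)
  refine ⟨⟨?_, ?_⟩, ⟨?_, ?_⟩⟩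
  · rintro ⟨c, hc, hf⟩
    refine ⟨c/2, by positivity, ?_⟩
    obtain ⟨n0, hn0⟩ := hu' (c/2) (by positivity)
    rw [frequently_atTop] at *
    intro M
    obtain ⟨N, hN, hcN⟩ := hf (a (max n0 M + 1))
    obtain ⟨n, hn, h1, h2⟩ := level a ha2 _ N hN
    refine ⟨n+2, by omega, ?_⟩
    have := (abs_le.1 (h n N h1 h2)).2
    have := hn0 n (by omega)
    linarith
  · rintro ⟨c, hc, hf⟩
    refine ⟨c/2, by positivity, ?_⟩
    obtain ⟨n0, hn0⟩ := hu' (c/2) (by positivity)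
    rw [frequently_atTop] at *
    intro M
    obtain ⟨m, hm, hcm⟩ := hf (max n0 M + 2)
    obtain ⟨n, rfl⟩ := Nat.exists_eq_add_of_le' (by omega : 2 ≤ m)
    refine ⟨a (n+1), ?_, ?_⟩
    · have := hge (n+1); omega
    · have := (abs_le.1 (h n (a (n+1)) le_rfl (hmono _))).1
      have := hn0 n (by omega)
      linarith
  · rintro ⟨c, hc, hf⟩
    refine ⟨c/2, by positivity, ?_⟩
    obtain ⟨n0, hn0⟩ := hu' (c/2) (by positivity)
    rw [eventually_atTop] at *
    obtain ⟨M, hM⟩ := hf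
    refine ⟨max n0 M + 2, fun m hm => ?_⟩
    obtain ⟨n, rfl⟩ := Nat.exists_eq_add_of_le' (by omega : 2 ≤ m)
    have h0 := hM (a (n+1)) (by have := hge (n+1); omega)
    have := (abs_le.1 (h n (a (n+1)) le_rfl (hmono _))).2
    have := hn0 n (by omega)
    linarith
  · rintro ⟨c, hc, hf⟩
    refine ⟨c/2, by positivity, ?_⟩
    obtain ⟨n0, hn0⟩ := hu' (c/2) (by positivity)
    rw [eventually_atTop] at *
    obtain ⟨M, hM⟩ := hf
    refine ⟨a (max n0 M + 1), fun N hN => ?_⟩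
    obtain ⟨n, hn, h1, h2⟩ := level a ha2 _ N hN
    have h0 := hM (n+2) (by omega)
    have := (abs_le.1 (h n N h1 h2)).1
    have := hn0 n (by omega)
    linarith

end Abstract

lemma key_equiv {k : ℕ} {P : Set (ℕ → Fin k)} (D : TData k P) (hD : D.Small) (y z : ℕ → Fin k)
    (L : ℕ) :
    (0 < upperDensity (visits (D.T y) (cyl z L)) ↔ 0 < upperDensity (visits y (cyl z L))) ∧
    (0 < lowerDensity (visits (D.T y) (cyl z L)) ↔ 0 < lowerDensity (visits y (cyl z L))) := by
  rw [upper_pos_iff, upper_pos_iff, lower_pos_iff, lower_pos_iff]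
  set a : ℕ → ℕ := fun n => (D.A y n).length with hadef
  set c : ℕ → ℕ := fun n => (D.C n).length with hcdef
  have ha : ∀ n, a (n+1) = a n + c n + a n ^ 2 * (n+1) + a n := A_len_succ D y
  have ha2 : ∀ n, 2 ^ n ≤ a n := A_len_ge D y
  have hv := verr_tendsto a c (L+1) ha2 (hD y)
  have i1 : Tendsto (fun n : ℕ => (2:ℝ) / ((n:ℝ)+1)) atTop (nhds 0) := by
    have := (tendsto_one_div_add_atTop_nhds_zero_nat (𝕜 := ℝ)).const_mul (2:ℝ)
    simpa [div_eq_mul_inv] using this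
  refine transfer (fun N => (cnt (visits (D.T y) (cyl z L)) N : ℝ) / N)
    (fun N => (cnt (visits y (cyl z L)) N : ℝ) / N) a
    (fun n => verr a c (L+1) n + 2 / ((n:ℝ)+1) + verr a c (L+1) (n+1)) ha2
    (fun n => by rw [ha n]; omega) ?_ ?_
  · have := (hv.add i1).add ((tendsto_add_atTop_iff_nat 1).2 hv)
    simpa using this
  · intro n N hN hN'
    refine main2 (cnt (visits (D.T y) (cyl z L))) (cnt (visits y (cyl z L))) a c (L+1)
      (cnt_le _) (cnt_le _) (fun m r => cnt_mono _ (by omega)) (fun m r => cnt_add_le _ m r)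
      (fun m r => cnt_mono _ (by omega)) (fun m r => cnt_add_le _ m r) ?_ ha
      (fun n => (Nat.one_le_two_pow).trans (ha2 n)) n N hN hN'
    intro n m hm
    exact block_count (D.T y) y z L (a n + c n + m * (n+1)) (n+1)
      (fun i hi => T_block D y n m i hm hi)

/-- **Remark.** For a proper subshift `P ⊊ Σ_k` and the map `T` constructed from `P`,
`ω_{d̄}(T(y)) = ω_{d̄}(y)` and `ω_{d̲}(T(y)) = ω_{d̲}(y)` for every `y ∈ P`. -/
theorem T_preserves_density_omega (k : ℕ) (hk : 2 ≤ k)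
    (P : Set (ℕ → Fin k)) (hP : IsSubshift P) (hproper : P ≠ Set.univ)
    (D : TData k P) (hD : D.Small) (y : ℕ → Fin k) (hy : y ∈ P) :
    statOmega upperDensity (D.T y) = statOmega upperDensity y ∧
    statOmega lowerDensity (D.T y) = statOmega lowerDensity y := by
  rw [statOmega_cyl upperDensity (fun _ _ h h' => upper_pos_mono h h'),
    statOmega_cyl upperDensity (fun _ _ h h' => upper_pos_mono h h'),
    statOmega_cyl lowerDensity (fun _ _ h h' => lower_pos_mono h h'),
    statOmega_cyl lowerDensity (fun _ _ h h' => lower_pos_mono h h')]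
  constructor
  · ext z
    exact forall_congr' fun L => (key_equiv D hD y z L).1
  · ext z
    exact forall_congr' fun L => (key_equiv D hD y z L).2
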